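/- arXiv:1703.04026 — 2 statements merged into one kernel-verified Lean document; each statement's English description precedes it below -/
import Mathlib

section
/- For every discount factor λ ∈ [0,1), every initial state s₀ ∈ S, every player i ∈ I, every partition 𝒟^i of the set of states, every cutoff vector c^i ∈ ℝ^{𝒟^i}, every stationary strategy x^i of player i, and every strategy profile σ^{-i} ∈ Σ^{-i} of the other players, there is a pure stationary strategy profile x^{-i} of the players other than i such that γ̂^i_λ(s₀,x^i,σ^{-i};𝒟^i,c^i) ≥ γ̂^i_λ(s₀,x^i,x^{-i};𝒟^i,c^i). -/
open MeasureTheory Filter Topology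
open scoped ENNReal

noncomputable section

/-- A finite stochastic game: a finite set of players `I`, a finite set of states `S`,
finite nonempty action sets `A i s`, stage payoffs `u` bounded by `1` in absolute value,
and transition probabilities `q`. -/
structure StocGame where
  (I : Type)
  (S : Type)
  (A : I → S → Type)
  [fintypeI : Fintype I]
  [fintypeS : Fintype S]
  [decI : DecidableEq I]
  [decS : DecidableEq S]
  [fintypeA : ∀ i s, Fintype (A i s)]
  [decA : ∀ i s, DecidableEq (A i s)]
  [nonemptyA : ∀ i s, Nonempty (A i s)]
  (u : I → (s : S) → ((j : I) → A j s) → ℝ)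
  (u_bdd : ∀ i s a, |u i s a| ≤ 1)
  (q : (s : S) → ((j : I) → A j s) → S → ℝ)
  (q_nonneg : ∀ s a s', 0 ≤ q s a s')
  (q_sum : ∀ s a, ∑ s', q s a s' = 1)

namespace StocGame

attribute [instance] fintypeI fintypeS decI decS fintypeA decA nonemptyA

/-- A mixed action over a finite set of actions. -/
abbrev Mixed (α : Type) [Fintype α] : Type := {f : α → ℝ // (∀ a, 0 ≤ f a) ∧ ∑ a, f a = 1}

variable {G : StocGame}

/-- Action profiles available at state `s`. -/
abbrev Prof (G : StocGame) (s : G.S) : Type := (j : G.I) → G.A j s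

/-- A pair of a state together with an action profile at that state. -/
abbrev Step (G : StocGame) : Type := Σ s : G.S, G.Prof s

/-- A finite history: a (reversed) list of past (state, action profile) steps,
together with the current state. -/
abbrev Hist (G : StocGame) : Type := List G.Step × G.S

/-- A behavior strategy of player `i`. -/
abbrev BStrat (G : StocGame) (i : G.I) : Type := (h : G.Hist) → Mixed (G.A i h.2)

/-- A (behavior) strategy profile. -/
abbrev Profile (G : StocGame) : Type := (i : G.I) → G.BStrat i

/-- A stationary strategy of player `i`. -/
abbrev Stat (G : StocGame) (i : G.I) : Type := (s : G.S) → Mixed (G.A i s)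

/-- A stationary strategy profile. -/
abbrev StatProf (G : StocGame) : Type := (i : G.I) → G.Stat i

/-- The behavior strategy profile induced by a stationary strategy profile. -/
def toB (x : G.StatProf) : G.Profile := fun i h => x i h.2

/-- The behavior strategy induced by a stationary strategy. -/
def toB1 {i : G.I} (x : G.Stat i) : G.BStrat i := fun h => x h.2

/-- A stationary strategy profile is pure if at every state each player
puts probability `1` on a single action. -/
def IsPureStat (x : G.StatProf) : Prop :=
  ∀ (i : G.I) (s : G.S), ∃ a : G.A i s, ∀ b, (x i s).1 b = if b = a then 1 else 0

/-- The probability, under strategy profile `σ` and initial state `s0`, that the play follows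
the finite history whose (reversed) list of steps is the first argument and whose current
state is the second argument. -/
def probHistAux (s0 : G.S) (σ : G.Profile) : List G.Step → G.S → ℝ
  | [], s => if s = s0 then 1 else 0
  | ⟨s', a⟩ :: rest, s =>
      probHistAux s0 σ rest s' * (∏ i, (σ i (rest, s')).1 (a i)) * G.q s' a s

/-- The probability that the play follows the finite history `h`. -/
def probHist (s0 : G.S) (σ : G.Profile) (h : G.Hist) : ℝ := probHistAux s0 σ h.1 h.2

/-- The expected `lam`-discounted time `t_lam(s0,σ;s,a)` that the play spends at the
state-action pair `st = (s,a)`. -/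
def tStep (lam : ℝ) (s0 : G.S) (σ : G.Profile) (st : G.Step) : ℝ :=
  (1 - lam) *
    ∑' h : G.Hist, (if h.1.head? = some st then lam ^ (h.1.length - 1) * probHist s0 σ h else 0)

/-- The expected `lam`-discounted time that the play spends in the set of states `D`. -/
def tSet (lam : ℝ) (s0 : G.S) (σ : G.Profile) (D : Finset G.S) : ℝ :=
  ∑ st : G.Step, if st.1 ∈ D then tStep lam s0 σ st else 0

/-- The `lam`-discounted (unnormalized) payoff `U^i_lam(s0,σ;D)` that player `i` receives
while the play is in `D`. -/
def UD (lam : ℝ) (s0 : G.S) (σ : G.Profile) (i : G.I) (D : Finset G.S) : ℝ :=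
  ∑ st : G.Step, if st.1 ∈ D then tStep lam s0 σ st * G.u i st.1 st.2 else 0

/-- The `lam`-discounted payoff of player `i`. -/
def payoffD (lam : ℝ) (s0 : G.S) (σ : G.Profile) (i : G.I) : ℝ :=
  ∑ st : G.Step, tStep lam s0 σ st * G.u i st.1 st.2

/-- `Di` is a partition of the set of states. -/
def IsPartitionF (Di : Finset (Finset G.S)) : Prop :=
  ∀ s : G.S, ∃! D : Finset G.S, D ∈ Di ∧ s ∈ D

/-- The payoff of player `i` in the modified game, given the partition `Di` and
the cutoffs `c`. -/
def modPayoff (lam : ℝ) (s0 : G.S) (σ : G.Profile) (i : G.I)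
    (Di : Finset (Finset G.S)) (c : Finset G.S → ℝ) : ℝ :=
  ∑ D ∈ Di, min (UD lam s0 σ i D) (tSet lam s0 σ D * c D)

/-- The `lam`-discounted min-max value of player `i` in the original game. -/
def minmaxOrig (G : StocGame) (lam : ℝ) (s0 : G.S) (i : G.I) : ℝ :=
  ⨅ σ : G.Profile, ⨆ σi : G.BStrat i, payoffD lam s0 (Function.update σ i σi) i

/-- The `lam`-discounted max-min value of player `i` in the original game. -/
def maxminOrig (G : StocGame) (lam : ℝ) (s0 : G.S) (i : G.I) : ℝ :=
  ⨆ σi : G.BStrat i, ⨅ σ : G.Profile, payoffD lam s0 (Function.update σ i σi) i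

/-- The min-max value of player `i` in the modified game. -/
def minmaxMod (G : StocGame) (lam : ℝ) (s0 : G.S) (i : G.I)
    (Di : Finset (Finset G.S)) (c : Finset G.S → ℝ) : ℝ :=
  ⨅ σ : G.Profile, ⨆ σi : G.BStrat i,
    modPayoff lam s0 (Function.update σ i σi) i Di c

/-- The max-min value of player `i` in the modified game. -/
def maxminMod (G : StocGame) (lam : ℝ) (s0 : G.S) (i : G.I)
    (Di : Finset (Finset G.S)) (c : Finset G.S → ℝ) : ℝ :=
  ⨆ σi : G.BStrat i, ⨅ σ : G.Profile,
    modPayoff lam s0 (Function.update σ i σi) i Di c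

/-- The min-max value in stationary strategies of player `i` in the modified game. -/
def minmaxModStat (G : StocGame) (lam : ℝ) (s0 : G.S) (i : G.I)
    (Di : Finset (Finset G.S)) (c : Finset G.S → ℝ) : ℝ :=
  ⨅ x : G.StatProf, ⨆ xi : G.Stat i,
    modPayoff lam s0 (Function.update (toB x) i (toB1 xi)) i Di c

/-- The max-min value in stationary strategies of player `i` in the modified game. -/
def maxminModStat (G : StocGame) (lam : ℝ) (s0 : G.S) (i : G.I)
    (Di : Finset (Finset G.S)) (c : Finset G.S → ℝ) : ℝ :=
  ⨆ xi : G.Stat i, ⨅ x : G.StatProf,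
    modPayoff lam s0 (Function.update (toB x) i (toB1 xi)) i Di c

/-! ### Plays and the induced measure -/

/-- A play: the infinite sequence of (state, action profile) pairs. -/
abbrev Play (G : StocGame) : Type := ℕ → G.Step

instance : MeasurableSpace G.Step := ⊤

/-- The finite history consisting of the first `n` stages of the play `p`
(reversed list of the first `n` steps, together with the state at stage `n`). -/
def histOf (p : G.Play) : ℕ → G.Hist
  | 0 => ([], (p 0).1)
  | n + 1 => ((p n) :: (histOf p n).1, (p (n + 1)).1)

/-- The cylinder set of plays whose initial segment is the finite history `h`. -/
def cylSet (h : G.Hist) : Set G.Play := {p | histOf p h.1.length = h}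

/-- `μfam` is the family of probability measures on plays induced (via the
Ionescu–Tulcea theorem) by the initial state and the strategy profile:
it is characterized by being a probability measure giving each cylinder set
the probability of the corresponding finite history. -/
def IsInduced (μfam : G.S → G.Profile → Measure G.Play) : Prop :=
  (∀ s0 σ, IsProbabilityMeasure (μfam s0 σ)) ∧
  ∀ (s0 : G.S) (σ : G.Profile) (h : G.Hist),
    μfam s0 σ (cylSet h) = ENNReal.ofReal (probHist s0 σ h)

/-- A bounded stopping time (with respect to the filtration generated by finite histories). -/
def IsBddST (τ : G.Play → ℕ) : Prop :=
  (∃ B, ∀ p, τ p ≤ B) ∧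
  ∀ p p' n, τ p = n → histOf p n = histOf p' n → τ p' = n

/-- Two states lie in the same element of the partition `Di`. -/
def sameOf (Di : Finset (Finset G.S)) (s s' : G.S) : Prop := ∃ D ∈ Di, s ∈ D ∧ s' ∈ D

open Classical in
/-- The number of switches between elements of a partition along a play,
where the partition is described through the relation `r` ("being in the same element"). -/
def Zsw (r : G.S → G.S → Prop) (p : G.Play) : ℝ≥0∞ :=
  ∑' n : ℕ, if r (p n).1 (p (n + 1)).1 then 0 else 1

/-- The stopping times `τ^𝒟_k` indicating when the play moves from one element of
the partition (described by the relation `r`) to another. -/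
def switchT (r : G.S → G.S → Prop) (p : G.Play) : ℕ → ℕ∞
  | 0 => 0
  | k + 1 => sInf {n : ℕ∞ | ∃ m : ℕ, n = (m : ℕ∞) ∧ switchT r p k < (m : ℕ∞) ∧
      ¬ r (p (m - 1)).1 (p m).1}

/-- The expected average payoff of player `i` in the `N`-stage game. -/
def payoffN (μfam : G.S → G.Profile → Measure G.Play) (N : ℕ) (s0 : G.S)
    (σ : G.Profile) (i : G.I) : ℝ :=
  (∫ p, (∑ n ∈ Finset.range N, G.u i (p n).1 (p n).2) ∂(μfam s0 σ)) / N

/-- `σi` is a uniform `ε`-max-min strategy of player `i` (with respect to the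
uniform max-min value function `v`). -/
def UnifMaxMin (μfam : G.S → G.Profile → Measure G.Play) (v : G.S → ℝ) (i : G.I)
    (σi : G.BStrat i) (ε : ℝ) : Prop :=
  ∃ lam0 : ℝ, 0 ≤ lam0 ∧ lam0 < 1 ∧ ∃ N0 : ℕ,
    ∀ (s0 : G.S) (σ : G.Profile),
      (∀ lam : ℝ, lam0 < lam → lam < 1 →
        v s0 - ε ≤ payoffD lam s0 (Function.update σ i σi) i) ∧
      (∀ τ : G.Play → ℕ, IsBddST τ →
        (N0 : ℝ) ≤ ∫ p, (τ p : ℝ) ∂(μfam s0 (Function.update σ i σi)) →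
        (v s0 - ε) * ∫ p, (τ p : ℝ) ∂(μfam s0 (Function.update σ i σi)) ≤
          ∫ p, (∑ n ∈ Finset.range (τ p), G.u i (p n).1 (p n).2)
            ∂(μfam s0 (Function.update σ i σi)))

/-- `σi` is `(𝒟,ε)`-max-min preserving, where the partition `𝒟` is described by the
relation `r`, and the conditional-expectation requirement is expressed through
integrals over the atoms (cylinder sets) of the σ-algebra of the stopping time `τ^𝒟_k`. -/
def PreservingPart (μfam : G.S → G.Profile → Measure G.Play) (v : G.S → ℝ)
    (r : G.S → G.S → Prop) (i : G.I) (σi : G.BStrat i) (ε : ℝ) : Prop :=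
  ∀ (s0 : G.S) (σ : G.Profile) (k : ℕ) (τ' : G.Play → ℕ), IsBddST τ' →
    (∀ p, switchT r p k ≠ ⊤ →
      switchT r p k < (τ' p : ℕ∞) ∧ (τ' p : ℕ∞) ≤ switchT r p (k + 1)) →
    ∀ h : G.Hist, (∀ p ∈ cylSet h, switchT r p k = (h.1.length : ℕ∞)) →
      ∫ p in cylSet h, (v h.2 - ε) ∂(μfam s0 (Function.update σ i σi)) ≤
        ∫ p in cylSet h, v ((p (τ' p)).1) ∂(μfam s0 (Function.update σ i σi))

/-- `σi` is `ε`-max-min preserving (with respect to arbitrary bounded stopping times);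
again the conditional-expectation requirement is expressed through integrals over the
atoms of the σ-algebra of the stopping time `τ`. -/
def PreservingST (μfam : G.S → G.Profile → Measure G.Play) (v : G.S → ℝ) (i : G.I)
    (σi : G.BStrat i) (ε : ℝ) : Prop :=
  ∀ (s0 : G.S) (σ : G.Profile) (τ τ' : G.Play → ℕ), IsBddST τ → IsBddST τ' →
    (∀ p, τ p < τ' p) →
    ∀ h : G.Hist, (∀ p ∈ cylSet h, τ p = h.1.length) →
      ∫ p in cylSet h, (v h.2 - ε) ∂(μfam s0 (Function.update σ i σi)) ≤
        ∫ p in cylSet h, v ((p (τ' p)).1) ∂(μfam s0 (Function.update σ i σi))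

/-- A history enters a new element of the partition (described by `r`) at its final stage. -/
def entersNew (r : G.S → G.S → Prop) (h : G.Hist) : Prop :=
  match h.1 with
  | [] => True
  | st :: _ => ¬ r st.1 h.2

/-- `σi` is `𝒟`-Markovian: its continuation strategy coincides after any two finite histories
that end at the same state and whose final stage enters a new element of the partition
(described by `r`). -/
def Markovian (r : G.S → G.S → Prop) {i : G.I} (σi : G.BStrat i) : Prop :=
  ∀ h h' : G.Hist, h.2 = h'.2 → entersNew r h → entersNew r h' →
    ∀ (l : List G.Step) (s'' : G.S), σi (l ++ h.1, s'') = σi (l ++ h'.1, s'')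

open Classical in
/-- The portion of the history since the last time the play entered a new element of the
partition (described by `r`): (reversed) list of steps, given the current state. -/
def philist (r : G.S → G.S → Prop) : List G.Step → G.S → List G.Step
  | [], _ => []
  | st :: rest, s => if r st.1 s then st :: philist r rest st.1 else []

/-- The restart strategy `σ^i_𝒟`: whenever the play enters a new element of the partition
(described by `r`), player `i` forgets past play and restarts playing `σi`. -/
def restart {i : G.I} (σi : G.BStrat i) (r : G.S → G.S → Prop) : G.BStrat i :=
  fun h => σi (philist r h.1 h.2, h.2)

/-- The partition `Di` satisfies Property P with respect to player `i`
(whose uniform max-min value function is `v`). -/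
def PropertyP (μfam : G.S → G.Profile → Measure G.Play) (v : G.S → ℝ) (i : G.I)
    (Di : Finset (Finset G.S)) : Prop :=
  ∃ ζ : ℝ, 0 < ζ ∧ ∀ ε : ℝ, 0 < ε → ∃ σi : G.BStrat i,
    Markovian (sameOf Di) σi ∧ UnifMaxMin μfam v i σi ε ∧
    ∀ (s0 : G.S) (σ : G.Profile), ∃ E : Set G.Play,
      ENNReal.ofReal (1 - ε) < μfam s0 (Function.update σ i σi) E ∧
      ∫⁻ p in E, Zsw (sameOf Di) p ∂(μfam s0 (Function.update σ i σi)) ≤ ENNReal.ofReal ζ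

/-- The strategy profile `σ` (whose `i`-th coordinate is the strategy of player `i`) makes
player `i`'s strategy a uniform `𝒟`-subgame-perfect `ε`-min-max strategy against the others'
strategies, at the initial state `s0`; `vbar` is the uniform min-max value function of
player `i`, and the partition `𝒟` is described by the relation `r`.  Conditional-expectation
requirements are expressed through integrals over the atoms (cylinder sets) of the σ-algebra
of the stopping time `τ^𝒟_k`. -/
def SubgamePerfect (μfam : G.S → G.Profile → Measure G.Play) (vbar : G.S → ℝ)
    (r : G.S → G.S → Prop) (i : G.I) (σ : G.Profile) (s0 : G.S) (ε : ℝ) : Prop :=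
  ∃ N0 : ℕ, 0 < N0 ∧
    (∀ N : ℕ, N0 ≤ N → vbar s0 - ε ≤ payoffN μfam N s0 σ i) ∧
    (∀ (k : ℕ) (τ : G.Play → ℕ), IsBddST τ → (∀ p, switchT r p k ≤ (τ p : ℕ∞)) →
      ∀ h : G.Hist, (∀ p ∈ cylSet h, switchT r p k = (h.1.length : ℕ∞)) →
        (∫ p in cylSet h, (vbar h.2 - ε) ∂(μfam s0 σ) ≤
          ∫ p in cylSet h, vbar ((p (τ p)).1) ∂(μfam s0 σ)) ∧
        ((N0 : ℝ) * (μfam s0 σ (cylSet h)).toReal ≤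
            ∫ p in cylSet h, ((τ p : ℝ) - (h.1.length : ℝ)) ∂(μfam s0 σ) →
          (vbar h.2 - ε) * ∫ p in cylSet h, ((τ p : ℝ) - (h.1.length : ℝ)) ∂(μfam s0 σ) ≤
            ∫ p in cylSet h, (∑ n ∈ Finset.Ico h.1.length (τ p), G.u i (p n).1 (p n).2)
              ∂(μfam s0 σ)))

/-- The partition `Di` satisfies Property P' with respect to player `i`
(whose uniform min-max value function is `vbar`). -/
def PropertyP' (μfam : G.S → G.Profile → Measure G.Play) (vbar : G.S → ℝ) (i : G.I)
    (Di : Finset (Finset G.S)) : Prop :=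
  ∃ ζ : ℝ, 0 < ζ ∧ ∀ ε : ℝ, 0 < ε → ∀ (s0 : G.S) (σ : G.Profile), ∃ σi : G.BStrat i,
    SubgamePerfect μfam vbar (sameOf Di) i (Function.update σ i σi) s0 ε ∧
    ∃ E : Set G.Play,
      ENNReal.ofReal (1 - ε) ≤ μfam s0 (Function.update σ i σi) E ∧
      ∫⁻ p in E, Zsw (sameOf Di) p ∂(μfam s0 (Function.update σ i σi)) ≤ ENNReal.ofReal ζ

/-! ### Reachability, closed and strongly controllable sets -/

/-- The first arrival time to the set of states `C`. -/
def hitT (C : Set G.S) (p : G.Play) : ℕ∞ :=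
  sInf {n : ℕ∞ | ∃ m : ℕ, n = (m : ℕ∞) ∧ (p m).1 ∈ C}

/-- State `s` leads in `D` to state `s'`. -/
def LeadsIn (μfam : G.S → G.Profile → Measure G.Play) (D : Set G.S) (s s' : G.S) : Prop :=
  ∃ σ : G.Profile, μfam s σ {p | hitT {s'} p < hitT Dᶜ p} = 1

/-- The states `s` and `s'` are `D`-siblings. -/
def Siblings (μfam : G.S → G.Profile → Measure G.Play) (D : Set G.S) (s s' : G.S) : Prop :=
  LeadsIn μfam D s s' ∧ LeadsIn μfam D s' s

/-- The probability `q(D | s, a)` that the next state lies in `D`. -/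
def qOf (D : Set G.S) (s : G.S) (a : G.Prof s) : ℝ := ∑ s', D.indicator (G.q s a) s'

/-- The set of states `D` is closed. -/
def ClosedSet (G : StocGame) (D : Set G.S) : Prop :=
  ∀ s ∈ D, ∀ a : G.Prof s, qOf D s a = 1

/-- The set of states `D` is strongly controllable. -/
def StronglyContr (G : StocGame) (D : Set G.S) : Prop :=
  ∃ iD : G.I, ∃ sD ∈ D, ∃ atil : G.A iD sD,
    ∀ s ∈ D, ∀ a : G.Prof s, qOf D s a < 1 → s = sD ∧ HEq (a iD) atil

/-- The element of the partition `𝒟` (by the vector of uniform min-max values `v`)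
that contains the state `s`. -/
def Dv (v : G.I → G.S → ℝ) (s : G.S) : Set G.S := {s' | ∀ i, v i s' = v i s}

/-- The element of the refined partition `𝒟*` (refining `𝒟` by the `D`-siblings relation)
that contains the state `s`. -/
def DstarCl (μfam : G.S → G.Profile → Measure G.Play) (v : G.I → G.S → ℝ) (s : G.S) :
    Set G.S := {s' | s' ∈ Dv v s ∧ Siblings μfam (Dv v s) s s'}

/-- The stochastic game is strongly controllable: every element of `𝒟*` is either closed
or strongly controllable. -/
def StronglyControllableGame (G : StocGame) (μfam : G.S → G.Profile → Measure G.Play)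
    (v : G.I → G.S → ℝ) : Prop :=
  ∀ s : G.S, ClosedSet G (DstarCl μfam v s) ∨ StronglyContr G (DstarCl μfam v s)

end StocGame

/-- A set `X ⊆ ℝ^ι` is monovex if every two points of `X` are connected by a continuous
path inside `X` all of whose coordinates are monotone. -/
def Monovex {ι : Type} (X : Set (ι → ℝ)) : Prop :=
  ∀ x ∈ X, ∀ y ∈ X, ∃ f : ℝ → ι → ℝ,
    ContinuousOn f (Set.Icc 0 1) ∧ (∀ t ∈ Set.Icc (0 : ℝ) 1, f t ∈ X) ∧
    f 0 = x ∧ f 1 = y ∧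
    ∀ j : ι, MonotoneOn (fun t => f t j) (Set.Icc 0 1) ∨
      AntitoneOn (fun t => f t j) (Set.Icc 0 1)

end

namespace StocGame

/-- The finite set of lists of length `n` over a finite type. -/
def listsOfLength (α : Type) [Fintype α] : ℕ → Finset (List α)
  | 0 => {[]}
  | n + 1 => (Finset.univ ×ˢ listsOfLength α n).map
      ⟨fun p : α × List α => p.1 :: p.2, fun p p' h => by
        simp only [List.cons.injEq] at h
        exact Prod.ext h.1 h.2⟩

theorem mem_listsOfLength {α : Type} [Fintype α] (n : ℕ) (l : List α) :
    l ∈ listsOfLength α n ↔ l.length = n := by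
  induction n generalizing l with
  | zero => simp [listsOfLength]
  | succ n ih => cases l with
    | nil => simp [listsOfLength]
    | cons a l =>
      rw [List.length_cons, Nat.add_right_cancel_iff, ← ih, listsOfLength, Finset.mem_map]
      constructor
      · rintro ⟨p, hp, h⟩
        obtain ⟨rfl, rfl⟩ := List.cons.inj h
        exact (Finset.mem_product.1 hp).2
      · exact fun h => ⟨(a, l), Finset.mem_product.2 ⟨Finset.mem_univ a, h⟩, rfl⟩

theorem sum_listsOfLength_succ {α : Type} [Fintype α] (n : ℕ) (f : List α → ℝ) :
    ∑ l ∈ listsOfLength α (n + 1), f l = ∑ a, ∑ l ∈ listsOfLength α n, f (a :: l) := by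
  rw [listsOfLength, Finset.sum_map, Finset.sum_product]
  rfl

variable {G : StocGame}

theorem probHistAux_nonneg (s0 : G.S) (σ : G.Profile) (l : List G.Step) (s : G.S) :
    0 ≤ probHistAux s0 σ l s := by
  induction l generalizing s with
  | nil => simp only [probHistAux]; split_ifs <;> norm_num
  | cons st l ih =>
    exact mul_nonneg (mul_nonneg (ih _) (Finset.prod_nonneg fun j _ => (σ j _).2.1 _))
      (G.q_nonneg _ _ _)

/-- The probability that independent mixed actions `τ` produce the action profile `a`. -/
def profProb {s : G.S} (τ : (j : G.I) → Mixed (G.A j s)) (a : G.Prof s) : ℝ :=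
  ∏ j, (τ j).1 (a j)

theorem profProb_nonneg {s : G.S} (τ : (j : G.I) → Mixed (G.A j s)) (a : G.Prof s) :
    0 ≤ profProb τ a := Finset.prod_nonneg fun j _ => (τ j).2.1 _

theorem sum_profProb {s : G.S} (τ : (j : G.I) → Mixed (G.A j s)) :
    ∑ a, profProb τ a = 1 := by
  have h := Finset.prod_univ_sum (fun j : G.I => (Finset.univ : Finset (G.A j s)))
    (fun j a => (τ j).1 a)
  rw [Fintype.piFinset_univ] at h
  unfold profProb
  rw [← h]
  exact Finset.prod_eq_one fun j _ => (τ j).2.2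

theorem profProb_update {s : G.S} (τ : (j : G.I) → Mixed (G.A j s)) (i : G.I)
    (a : G.Prof s) (b : G.A i s) :
    profProb τ (Function.update a i b) * (τ i).1 (a i) = profProb τ a * (τ i).1 b := by
  unfold profProb
  rw [← Finset.mul_prod_erase _ _ (Finset.mem_univ i),
    ← Finset.mul_prod_erase Finset.univ (fun j => (τ j).1 (a j)) (Finset.mem_univ i)]
  have h : ∏ j ∈ Finset.univ.erase i, (τ j).1 (Function.update a i b j)
      = ∏ j ∈ Finset.univ.erase i, (τ j).1 (a j) :=
    Finset.prod_congr rfl fun j hj => by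
      rw [Function.update_of_ne (Finset.ne_of_mem_erase hj)]
  rw [h, Function.update_self]
  ring

/-- Resampling the action of player `i` does not change expectations. -/
theorem sum_profProb_resample {s : G.S} (τ : (j : G.I) → Mixed (G.A j s)) (i : G.I)
    (g : G.Prof s → ℝ) :
    ∑ a, profProb τ a * ∑ b, (τ i).1 b * g (Function.update a i b) =
      ∑ a, profProb τ a * g a := by
  have h1 : ∑ p : G.Prof s × G.A i s,
        profProb τ p.1 * (τ i).1 p.2 * g (Function.update p.1 i p.2)
      = ∑ p : G.Prof s × G.A i s, profProb τ p.1 * (τ i).1 p.2 * g p.1 := by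
    refine Finset.sum_nbij' (fun p => (Function.update p.1 i p.2, p.1 i))
      (fun p => (Function.update p.1 i p.2, p.1 i)) ?_ ?_ ?_ ?_ ?_
    · simp
    · simp
    · simp
    · simp
    · intro p _
      simp only
      rw [profProb_update]
  rw [Fintype.sum_prod_type, Fintype.sum_prod_type] at h1
  calc _ = ∑ a, ∑ b, profProb τ a * (τ i).1 b * g (Function.update a i b) :=
        Finset.sum_congr rfl fun a _ => by
          rw [Finset.mul_sum]; exact Finset.sum_congr rfl fun b _ => by ring
    _ = _ := h1
    _ = _ := Finset.sum_congr rfl fun a _ => by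
        simp only
        rw [← Finset.sum_mul, ← Finset.mul_sum, (τ i).2.2, mul_one]

/-- The probability that the state at stage `n` is `s`. -/
def stateProb (s0 : G.S) (σ : G.Profile) (n : ℕ) (s : G.S) : ℝ :=
  ∑ l ∈ listsOfLength G.Step n, probHistAux s0 σ l s

/-- The probability that the step at stage `n` is `st`. -/
def stepProb (s0 : G.S) (σ : G.Profile) (n : ℕ) (st : G.Step) : ℝ :=
  ∑ l ∈ listsOfLength G.Step n,
    probHistAux s0 σ l st.1 * profProb (fun j => σ j (l, st.1)) st.2

theorem stateProb_nonneg (s0 : G.S) (σ : G.Profile) (n : ℕ) (s : G.S) :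
    0 ≤ stateProb s0 σ n s := Finset.sum_nonneg fun _ _ => probHistAux_nonneg _ _ _ _

theorem stepProb_nonneg (s0 : G.S) (σ : G.Profile) (n : ℕ) (st : G.Step) :
    0 ≤ stepProb s0 σ n st :=
  Finset.sum_nonneg fun _ _ => mul_nonneg (probHistAux_nonneg _ _ _ _) (profProb_nonneg _ _)

theorem stateProb_zero (s0 : G.S) (σ : G.Profile) (s : G.S) :
    stateProb s0 σ 0 s = if s = s0 then 1 else 0 := by
  simp [stateProb, listsOfLength, probHistAux]

theorem stateProb_succ (s0 : G.S) (σ : G.Profile) (n : ℕ) (s : G.S) :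
    stateProb s0 σ (n + 1) s = ∑ st : G.Step, stepProb s0 σ n st * G.q st.1 st.2 s := by
  rw [stateProb, sum_listsOfLength_succ]
  refine Finset.sum_congr rfl fun st _ => ?_
  rw [stepProb, Finset.sum_mul]
  rfl

theorem sum_stepProb_mul (s0 : G.S) (σ : G.Profile) (n : ℕ) (g : G.Step → ℝ) :
    ∑ st, stepProb s0 σ n st * g st =
      ∑ s, ∑ l ∈ listsOfLength G.Step n,
        probHistAux s0 σ l s * ∑ a, profProb (fun j => σ j (l, s)) a * g ⟨s, a⟩ := by
  rw [Fintype.sum_sigma]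
  refine Finset.sum_congr rfl fun s _ => ?_
  simp only [stepProb, Finset.sum_mul, Finset.mul_sum]
  rw [Finset.sum_comm]
  exact Finset.sum_congr rfl fun l _ => Finset.sum_congr rfl fun a _ => by ring

theorem sum_stepProb (s0 : G.S) (σ : G.Profile) (n : ℕ) :
    ∑ st, stepProb s0 σ n st = ∑ s, stateProb s0 σ n s := by
  have h := sum_stepProb_mul s0 σ n fun _ => 1
  simpa [sum_profProb, stateProb] using h

theorem sum_stateProb (s0 : G.S) (σ : G.Profile) (n : ℕ) :
    ∑ s, stateProb s0 σ n s = 1 := by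
  induction n with
  | zero => simp [stateProb_zero]
  | succ n ih =>
    simp only [stateProb_succ]
    rw [Finset.sum_comm]
    simp only [← Finset.mul_sum, G.q_sum, mul_one]
    rw [sum_stepProb, ih]

theorem stepProb_le_one (s0 : G.S) (σ : G.Profile) (n : ℕ) (st : G.Step) :
    stepProb s0 σ n st ≤ 1 := by
  rw [← sum_stateProb s0 σ n, ← sum_stepProb]
  exact Finset.single_le_sum (f := fun st => stepProb s0 σ n st)
    (fun st _ => stepProb_nonneg s0 σ n st) (Finset.mem_univ st)

/-- The histories with fewer than `N` past steps. -/
def histsBelow (G : StocGame) (N : ℕ) : Finset G.Hist :=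
  (Finset.range N).biUnion (listsOfLength G.Step) ×ˢ Finset.univ

theorem mem_histsBelow (N : ℕ) (h : G.Hist) : h ∈ histsBelow G N ↔ h.1.length < N := by
  simp [histsBelow, mem_listsOfLength]

theorem sum_histsBelow_succ (lam : ℝ) (s0 : G.S) (σ : G.Profile) (st : G.Step) (N : ℕ) :
    ∑ h ∈ histsBelow G (N + 1),
      (if h.1.head? = some st then lam ^ (h.1.length - 1) * probHist s0 σ h else 0) =
    ∑ n ∈ Finset.range N, lam ^ n * stepProb s0 σ n st := by
  rw [histsBelow, Finset.sum_product, Finset.sum_biUnion, Finset.sum_range_succ']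
  · have h0 : ∑ l ∈ listsOfLength G.Step 0, ∑ s : G.S,
        (if l.head? = some st then lam ^ (l.length - 1) * probHist s0 σ (l, s) else 0) = 0 := by
      simp [listsOfLength]
    rw [h0, add_zero]
    refine Finset.sum_congr rfl fun n _ => ?_
    rw [sum_listsOfLength_succ, Finset.sum_eq_single st]
    · rw [stepProb, Finset.mul_sum]
      refine Finset.sum_congr rfl fun l hl => ?_
      rw [mem_listsOfLength] at hl
      simp only [List.head?_cons, if_true, List.length_cons, hl, Nat.add_sub_cancel, probHist,
        probHistAux]
      rw [← Finset.mul_sum, ← Finset.mul_sum, G.q_sum, mul_one]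
      rfl
    · intro st' _ hne
      simp [hne]
    · simp
  · intro n _ m _ hnm
    rw [Function.onFun, Finset.disjoint_left]
    intro l hl hl'
    rw [mem_listsOfLength] at hl hl'
    exact hnm (hl.symm.trans hl')

theorem tendsto_tStep (lam : ℝ) (hlam0 : 0 ≤ lam) (hlam1 : lam < 1) (s0 : G.S)
    (σ : G.Profile) (st : G.Step) :
    Tendsto (fun N => (1 - lam) * ∑ n ∈ Finset.range N, lam ^ n * stepProb s0 σ n st) atTop
      (𝓝 (tStep lam s0 σ st)) := by
  set f : G.Hist → ℝ := fun h =>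
    if h.1.head? = some st then lam ^ (h.1.length - 1) * probHist s0 σ h else 0 with hf
  have hf0 : ∀ h, 0 ≤ f h := fun h => by
    simp only [hf]
    split_ifs
    · exact mul_nonneg (pow_nonneg hlam0 _) (probHistAux_nonneg _ _ _ _)
    · exact le_rfl
  have hmono : Monotone (histsBelow G) := fun N M hNM h => by
    simp only [mem_histsBelow]
    omega
  have htop : Tendsto (fun N => histsBelow G (N + 1)) atTop atTop :=
    (tendsto_atTop_finset_of_monotone hmono fun h =>
      ⟨h.1.length + 1, by simp [mem_histsBelow]⟩).comp (tendsto_add_atTop_nat 1)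
  have hsum : Summable f := by
    refine summable_of_sum_le (c := (1 - lam)⁻¹) hf0 fun u => ?_
    obtain ⟨N, hN⟩ := (htop.eventually_ge_atTop u).exists
    calc ∑ h ∈ u, f h ≤ ∑ h ∈ histsBelow G (N + 1), f h :=
          Finset.sum_le_sum_of_subset_of_nonneg hN fun h _ _ => hf0 h
      _ = ∑ n ∈ Finset.range N, lam ^ n * stepProb s0 σ n st := sum_histsBelow_succ ..
      _ ≤ ∑ n ∈ Finset.range N, lam ^ n := Finset.sum_le_sum fun n _ =>
          mul_le_of_le_one_right (pow_nonneg hlam0 n) (stepProb_le_one _ _ _ _)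
      _ ≤ ∑' n : ℕ, lam ^ n := (summable_geometric_of_lt_one hlam0 hlam1).sum_le_tsum _
          fun n _ => pow_nonneg hlam0 n
      _ = (1 - lam)⁻¹ := tsum_geometric_of_lt_one hlam0 hlam1
  have h := hsum.hasSum.comp htop
  simp only [Function.comp_def, hf, sum_histsBelow_succ] at h
  exact h.const_mul (1 - lam)

/-- If the continuation values `v` satisfy the one-stage inequality after every history,
then `v s0` is a lower bound for the discounted reward. -/
theorem le_sum_tStep (lam : ℝ) (hlam0 : 0 ≤ lam) (hlam1 : lam < 1) (s0 : G.S)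
    (σ : G.Profile) (r : G.Step → ℝ) (v : G.S → ℝ)
    (hv : ∀ (l : List G.Step) (s : G.S), v s ≤ ∑ a, profProb (fun j => σ j (l, s)) a *
      ((1 - lam) * r ⟨s, a⟩ + lam * ∑ s', G.q s a s' * v s')) :
    v s0 ≤ ∑ st, tStep lam s0 σ st * r st := by
  set V : ℕ → ℝ := fun n => ∑ s, stateProb s0 σ n s * v s with hV
  have hV0 : V 0 = v s0 := by simp [hV, stateProb_zero]
  have hVsucc : ∀ n, V (n + 1) =
      ∑ st : G.Step, stepProb s0 σ n st * ∑ s', G.q st.1 st.2 s' * v s' := fun n => by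
    simp only [hV, stateProb_succ, Finset.sum_mul, Finset.mul_sum]
    rw [Finset.sum_comm]
    exact Finset.sum_congr rfl fun _ _ => Finset.sum_congr rfl fun _ _ => by ring
  have hstep : ∀ n, V n ≤ (1 - lam) * ∑ st, stepProb s0 σ n st * r st + lam * V (n + 1) := by
    intro n
    have h1 := sum_stepProb_mul s0 σ n
      fun st => (1 - lam) * r st + lam * ∑ s', G.q st.1 st.2 s' * v s'
    have h2 : V n ≤ ∑ st : G.Step, stepProb s0 σ n st *
        ((1 - lam) * r st + lam * ∑ s', G.q st.1 st.2 s' * v s') := by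
      rw [h1]
      refine Finset.sum_le_sum fun s _ => ?_
      rw [stateProb, Finset.sum_mul]
      exact Finset.sum_le_sum fun l _ =>
        mul_le_mul_of_nonneg_left (hv l s) (probHistAux_nonneg _ _ _ _)
    refine h2.trans_eq ?_
    rw [hVsucc, Finset.mul_sum, Finset.mul_sum, ← Finset.sum_add_distrib]
    exact Finset.sum_congr rfl fun _ _ => by ring
  have hpartial : ∀ N, v s0 - lam ^ N * V N ≤
      ∑ st, ((1 - lam) * ∑ n ∈ Finset.range N, lam ^ n * stepProb s0 σ n st) * r st := by
    intro N
    induction N with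
    | zero => simp [hV0]
    | succ N ih =>
      have h3 := mul_le_mul_of_nonneg_left (hstep N) (pow_nonneg hlam0 N)
      have h4 : ∑ st, ((1 - lam) * ∑ n ∈ Finset.range (N + 1),
            lam ^ n * stepProb s0 σ n st) * r st =
          ∑ st, ((1 - lam) * ∑ n ∈ Finset.range N, lam ^ n * stepProb s0 σ n st) * r st +
          lam ^ N * ((1 - lam) * ∑ st, stepProb s0 σ N st * r st) := by
        rw [Finset.mul_sum, Finset.mul_sum, ← Finset.sum_add_distrib]
        exact Finset.sum_congr rfl fun _ _ => by rw [Finset.sum_range_succ]; ring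
      rw [h4, pow_succ]
      linarith
  have hVbdd : ∀ n, |V n| ≤ ∑ s, |v s| := fun n => by
    refine (Finset.abs_sum_le_sum_abs _ _).trans (Finset.sum_le_sum fun s _ => ?_)
    rw [abs_mul, abs_of_nonneg (stateProb_nonneg _ _ _ _)]
    refine mul_le_of_le_one_left (abs_nonneg _) ?_
    rw [← sum_stateProb s0 σ n]
    exact Finset.single_le_sum (f := fun s => stateProb s0 σ n s)
      (fun s _ => stateProb_nonneg s0 σ n s) (Finset.mem_univ s)
  have hlim : Tendsto (fun N => lam ^ N * V N) atTop (𝓝 0) :=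
    (tendsto_pow_atTop_nhds_zero_of_lt_one hlam0 hlam1).zero_mul_isBoundedUnder_le
      (isBoundedUnder_of ⟨∑ s, |v s|, hVbdd⟩)
  have hl := hlim.const_sub (v s0)
  rw [sub_zero] at hl
  exact le_of_tendsto_of_tendsto' hl
    (tendsto_finsetSum _ fun st _ =>
      (tendsto_tStep lam hlam0 hlam1 s0 σ st).mul_const (r st)) hpartial

theorem sum_tStep_le (lam : ℝ) (hlam0 : 0 ≤ lam) (hlam1 : lam < 1) (s0 : G.S)
    (σ : G.Profile) (r : G.Step → ℝ) (v : G.S → ℝ)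
    (hv : ∀ (l : List G.Step) (s : G.S), ∑ a, profProb (fun j => σ j (l, s)) a *
      ((1 - lam) * r ⟨s, a⟩ + lam * ∑ s', G.q s a s' * v s') ≤ v s) :
    ∑ st, tStep lam s0 σ st * r st ≤ v s0 := by
  have h := le_sum_tStep lam hlam0 hlam1 s0 σ (fun st => -r st) (fun s => -v s)
    fun l s => by
      refine (neg_le_neg (hv l s)).trans_eq ?_
      rw [← Finset.sum_neg_distrib]
      refine Finset.sum_congr rfl fun a _ => ?_
      simp only [mul_neg, Finset.sum_neg_distrib]
      ring
  simp only [mul_neg, Finset.sum_neg_distrib] at h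
  linarith

/-- The one-stage cost at `s` with continuation values `v`, when player `i` mixes according to
`xi` and the others follow the action profile `b`. -/
def stageCost (lam : ℝ) (i : G.I) (xi : G.Stat i) (r : G.Step → ℝ) (v : G.S → ℝ) (s : G.S)
    (b : G.Prof s) : ℝ :=
  ∑ c, (xi s).1 c * ((1 - lam) * r ⟨s, Function.update b i c⟩ +
    lam * ∑ s', G.q s (Function.update b i c) s' * v s')

theorem stageCost_le_add (lam : ℝ) (hlam0 : 0 ≤ lam) (i : G.I) (xi : G.Stat i)
    (r : G.Step → ℝ) (v w : G.S → ℝ) (s : G.S) (b : G.Prof s) :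
    stageCost lam i xi r v s b ≤ stageCost lam i xi r w s b + lam * dist v w := by
  have h1 : ∀ a : G.Prof s, ∑ s', G.q s a s' * v s' ≤ ∑ s', G.q s a s' * w s' + dist v w := by
    intro a
    calc ∑ s', G.q s a s' * v s' ≤ ∑ s', G.q s a s' * (w s' + dist v w) :=
          Finset.sum_le_sum fun s' _ => mul_le_mul_of_nonneg_left (by
            have h := (le_abs_self _).trans ((Real.dist_eq (v s') (w s')).symm.le.trans
              (dist_le_pi_dist v w s'))
            linarith) (G.q_nonneg _ _ _)
      _ = _ := by simp only [mul_add, Finset.sum_add_distrib, ← Finset.sum_mul, G.q_sum, one_mul]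
  calc stageCost lam i xi r v s b
      ≤ ∑ c, (xi s).1 c * (((1 - lam) * r ⟨s, Function.update b i c⟩ +
          lam * ∑ s', G.q s (Function.update b i c) s' * w s') + lam * dist v w) :=
        Finset.sum_le_sum fun c _ => mul_le_mul_of_nonneg_left (by
          have h := mul_le_mul_of_nonneg_left (h1 (Function.update b i c)) hlam0
          linarith) ((xi s).2.1 c)
    _ = _ := by
      rw [stageCost]
      simp only [mul_add _ _ (lam * dist v w), Finset.sum_add_distrib, ← Finset.sum_mul,
        (xi s).2.2, one_mul]

/-- The Bellman equation of the Markov decision problem faced by the players other than `i`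
has a solution. -/
theorem exists_bellman (lam : ℝ) (hlam0 : 0 ≤ lam) (hlam1 : lam < 1) (i : G.I)
    (xi : G.Stat i) (r : G.Step → ℝ) :
    ∃ (v : G.S → ℝ) (b : (s : G.S) → G.Prof s),
      (∀ s, stageCost lam i xi r v s (b s) = v s) ∧
      ∀ s a, v s ≤ stageCost lam i xi r v s a := by
  choose b hb using fun (v : G.S → ℝ) (s : G.S) =>
    Finite.exists_min (stageCost lam i xi r v s)
  set T : (G.S → ℝ) → G.S → ℝ := fun v s => stageCost lam i xi r v s (b v s) with hT
  have hle : ∀ v w s, T v s ≤ T w s + lam * dist v w := fun v w s =>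
    (hb v s (b w s)).trans (stageCost_le_add lam hlam0 i xi r v w s _)
  have hc : ContractingWith ⟨lam, hlam0⟩ T := by
    refine ⟨by exact_mod_cast hlam1, LipschitzWith.of_dist_le_mul fun v w => ?_⟩
    refine (dist_pi_le_iff (mul_nonneg hlam0 dist_nonneg)).2 fun s => ?_
    rw [Real.dist_eq, abs_sub_le_iff]
    have h1 := hle v w s
    have h2 := hle w v s
    rw [dist_comm w v] at h2
    change _ ≤ lam * _ ∧ _ ≤ lam * _
    constructor <;> linarith
  have hfix : T (ContractingWith.fixedPoint T hc) = ContractingWith.fixedPoint T hc :=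
    hc.fixedPoint_isFixedPt
  exact ⟨_, b _, fun s => congrFun hfix s, fun s a => (congrFun hfix s).symm.le.trans (hb _ s a)⟩

/-- The pure mixed action concentrated on `b`. -/
def pureMixed {α : Type} [Fintype α] [DecidableEq α] (b : α) : Mixed α :=
  ⟨fun a => if a = b then 1 else 0, fun a => by dsimp only; split_ifs <;> norm_num, by simp⟩

/-- Against a stationary strategy of player `i`, a linear functional of the discounted
occupation measure is minimized by a pure stationary profile. -/
theorem exists_pure_sum_tStep_le (lam : ℝ) (hlam0 : 0 ≤ lam) (hlam1 : lam < 1) (s0 : G.S)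
    (i : G.I) (xi : G.Stat i) (σ : G.Profile) (r : G.Step → ℝ) :
    ∃ x : G.StatProf, IsPureStat x ∧
      ∑ st, tStep lam s0 (Function.update (toB x) i (toB1 xi)) st * r st ≤
        ∑ st, tStep lam s0 (Function.update σ i (toB1 xi)) st * r st := by
  obtain ⟨v, b, hb, hv⟩ := exists_bellman lam hlam0 hlam1 i xi r
  have key : ∀ (ρ : G.Profile) (l : List G.Step) (s : G.S),
      ∑ a, profProb (fun j => Function.update ρ i (toB1 xi) j (l, s)) a *
        ((1 - lam) * r ⟨s, a⟩ + lam * ∑ s', G.q s a s' * v s') =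
      ∑ a, profProb (fun j => Function.update ρ i (toB1 xi) j (l, s)) a *
        stageCost lam i xi r v s a := by
    intro ρ l s
    rw [← sum_profProb_resample _ i]
    simp only [Function.update_self]
    rfl
  refine ⟨fun j s => pureMixed (b s j), fun j s => ⟨b s j, fun a => rfl⟩, ?_⟩
  refine (sum_tStep_le lam hlam0 hlam1 s0 _ r v fun l s => ?_).trans
    (le_sum_tStep lam hlam0 hlam1 s0 _ r v fun l s => ?_)
  · rw [key]
    refine le_of_eq ?_
    rw [← one_mul (v s), ← sum_profProb (fun j =>
      Function.update (toB fun j s => pureMixed (b s j)) i (toB1 xi) j (l, s)), Finset.sum_mul]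
    refine Finset.sum_congr rfl fun a _ => ?_
    by_cases hab : ∀ j, j ≠ i → a j = b s j
    · have h : ∀ c, Function.update a i c = Function.update (b s) i c := fun c => by
        funext j
        by_cases hj : j = i
        · subst hj; simp
        · simp [Function.update_of_ne hj, hab j hj]
      have h2 : stageCost lam i xi r v s a = stageCost lam i xi r v s (b s) := by
        simp only [stageCost, h]
      rw [h2, hb]
    · push Not at hab
      obtain ⟨j, hj, hne⟩ := hab
      have h0 : profProb (fun j =>
          Function.update (toB fun j s => pureMixed (b s j)) i (toB1 xi) j (l, s)) a = 0 := by
        refine Finset.prod_eq_zero (Finset.mem_univ j) ?_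
        simp only [Function.update_of_ne hj]
        exact if_neg hne
      rw [h0, zero_mul, zero_mul]
  · rw [key]
    calc v s = ∑ a, profProb (fun j => Function.update σ i (toB1 xi) j (l, s)) a * v s := by
          rw [← Finset.sum_mul, sum_profProb, one_mul]
      _ ≤ _ := Finset.sum_le_sum fun a _ =>
          mul_le_mul_of_nonneg_left (hv s a) (profProb_nonneg _ _)

open Classical in
/-- The total reward, when the reward on each `D ∈ Di` is `u` if `p D` holds and the cutoff
`c D` otherwise. -/
theorem sum_tStep_selected (lam : ℝ) (s0 : G.S) (σ : G.Profile) (i : G.I)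
    (Di : Finset (Finset G.S)) (c : Finset G.S → ℝ) (p : Finset G.S → Prop) :
    ∑ st : G.Step, tStep lam s0 σ st *
        (∑ D ∈ Di, if st.1 ∈ D then (if p D then G.u i st.1 st.2 else c D) else 0) =
      ∑ D ∈ Di, if p D then UD lam s0 σ i D else tSet lam s0 σ D * c D := by
  simp only [Finset.mul_sum]
  rw [Finset.sum_comm]
  refine Finset.sum_congr rfl fun D _ => ?_
  by_cases h : p D
  · simp [h, UD]
  · simp [h, tSet, Finset.sum_mul]

end StocGame

open StocGame in
/-- when player `i` plays a stationary strategy, his lowest modified payoff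
against arbitrary strategies of the others is attained against a pure stationary
strategy profile. -/
theorem stmt_16 (G : StocGame) (lam : ℝ) (hlam0 : 0 ≤ lam) (hlam1 : lam < 1) (s0 : G.S)
    (i : G.I) (Di : Finset (Finset G.S)) (hDi : IsPartitionF Di)
    (c : Finset G.S → ℝ) (xi : G.Stat i) (σ : G.Profile) :
    ∃ x : G.StatProf, IsPureStat x ∧
      modPayoff lam s0 (Function.update (toB x) i (toB1 xi)) i Di c ≤
        modPayoff lam s0 (Function.update σ i (toB1 xi)) i Di c := by
  classical
  set ρ : G.Profile := Function.update σ i (toB1 xi)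
  let p : Finset G.S → Prop := fun D => UD lam s0 ρ i D ≤ tSet lam s0 ρ D * c D
  obtain ⟨x, hx, hle⟩ := exists_pure_sum_tStep_le lam hlam0 hlam1 s0 i xi σ
    fun st => ∑ D ∈ Di, if st.1 ∈ D then (if p D then G.u i st.1 st.2 else c D) else 0
  refine ⟨x, hx, ?_⟩
  rw [sum_tStep_selected, sum_tStep_selected] at hle
  calc _ ≤ _ := Finset.sum_le_sum fun D _ => by
        split_ifs
        exacts [min_le_left _ _, min_le_right _ _]
    _ ≤ _ := hle
    _ = _ := Finset.sum_congr rfl fun D _ => by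
        split_ifs with h
        exacts [(min_eq_left h).symm, (min_eq_right (not_le.1 h).le).symm]
end

section
/- For every discount factor λ ∈ [0,1), every initial state s₀ ∈ S, every player i ∈ I, every partition 𝒟^i of the set of states, and every cutoff vector c^i ∈ ℝ^{𝒟^i}: underline-v̂^i_{λ,stat}(s₀;𝒟^i,c^i) ≤ underline-v̂^i_λ(s₀;𝒟^i,c^i); that is, the max-min value in stationary strategies of the modified game is at most the max-min value of the modified game. -/
open MeasureTheory Filter Topology
open scoped ENNReal

namespace StocGame

variable {G : StocGame}

instance {α : Type} [Fintype α] [Nonempty α] : Nonempty (Mixed α) := by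
  classical
  exact ⟨⟨fun b => if b = Classical.arbitrary α then 1 else 0,
    fun b => by dsimp only; split_ifs <;> norm_num, by simp⟩⟩

/-- The probability of the action profile `a` after the history `h` under `σ`. -/
def actProb (σ : G.Profile) (h : G.Hist) (a : G.Prof h.2) : ℝ := ∏ j, (σ j h).1 (a j)

lemma sum_prod_mixed {ι : Type} [Fintype ι] [DecidableEq ι] {α : ι → Type}
    [∀ j, Fintype (α j)] (p : ∀ j, Mixed (α j)) :
    ∑ a : (∀ j, α j), ∏ j, (p j).1 (a j) = 1 := by
  classical
  have h := Finset.prod_univ_sum (fun j => (Finset.univ : Finset (α j))) (fun j b => (p j).1 b)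
  rw [Fintype.piFinset_univ] at h
  rw [← h]
  exact Finset.prod_eq_one fun j _ => (p j).2.2

lemma actProb_nonneg (σ : G.Profile) (h : G.Hist) (a : G.Prof h.2) : 0 ≤ actProb σ h a :=
  Finset.prod_nonneg fun j _ => (σ j h).2.1 _

lemma sum_actProb (σ : G.Profile) (h : G.Hist) : ∑ a, actProb σ h a = 1 :=
  sum_prod_mixed fun j => σ j h

/-- Resampling one coordinate of a product distribution does not change expectations. -/
lemma sum_prod_mixed_resample {ι : Type} [Fintype ι] [DecidableEq ι] {α : ι → Type}
    [∀ j, Fintype (α j)] (p : ∀ j, Mixed (α j)) (i : ι) (F : (∀ j, α j) → ℝ) :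
    ∑ a : (∀ j, α j), (∏ j, (p j).1 (a j)) * ∑ b, (p i).1 b * F (Function.update a i b) =
      ∑ a : (∀ j, α j), (∏ j, (p j).1 (a j)) * F a := by
  have key (a : ∀ j, α j) (b : α i) :
      (∏ j, (p j).1 (a j)) * (p i).1 b =
        (∏ j, (p j).1 (Function.update a i b j)) * (p i).1 (a i) := by
    rw [← Finset.mul_prod_erase _ _ (Finset.mem_univ i),
      ← Finset.mul_prod_erase _ (fun j => (p j).1 (Function.update a i b j)) (Finset.mem_univ i)]
    have : ∏ j ∈ Finset.univ.erase i, (p j).1 (Function.update a i b j) =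
        ∏ j ∈ Finset.univ.erase i, (p j).1 (a j) :=
      Finset.prod_congr rfl fun j hj => by rw [Function.update_of_ne (Finset.ne_of_mem_erase hj)]
    rw [this, Function.update_self]
    ring
  let e : ((∀ j, α j) × α i) ≃ ((∀ j, α j) × α i) :=
    { toFun := fun x => (Function.update x.1 i x.2, x.1 i)
      invFun := fun x => (Function.update x.1 i x.2, x.1 i)
      left_inv := fun x => by simp
      right_inv := fun x => by simp }
  calc
    _ = ∑ x : (∀ j, α j) × α i,
          (∏ j, (p j).1 (x.1 j)) * (p i).1 x.2 * F (Function.update x.1 i x.2) := by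
        rw [Fintype.sum_prod_type]
        simp only [Finset.mul_sum, mul_assoc]
    _ = ∑ x : (∀ j, α j) × α i, (∏ j, (p j).1 (x.1 j)) * (p i).1 x.2 * F x.1 := by
        refine Fintype.sum_equiv e _ _ fun x => ?_
        rw [key]
        rfl
    _ = _ := by
        rw [Fintype.sum_prod_type]
        refine Finset.sum_congr rfl fun a _ => ?_
        dsimp only
        rw [← Finset.sum_mul, ← Finset.mul_sum, (p i).2.2, mul_one]

/-! ### Sums over finite histories -/

/-- A finite history is either an initial state or a shorter history followed by an action
profile and a new state. -/
def histEquiv (G : StocGame) : (G.S ⊕ (Σ h : G.Hist, G.Prof h.2 × G.S)) ≃ G.Hist where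
  toFun
    | Sum.inl s => ([], s)
    | Sum.inr ⟨h, a, s⟩ => (⟨h.2, a⟩ :: h.1, s)
  invFun
    | ([], s) => Sum.inl s
    | (⟨s', a⟩ :: rest, s) => Sum.inr ⟨(rest, s'), a, s⟩
  left_inv x := by rcases x with s | ⟨h, a, s⟩ <;> rfl
  right_inv h := by
    obtain ⟨l, s⟩ := h
    cases l <;> rfl

lemma histEquiv_inl (s : G.S) : histEquiv G (Sum.inl s) = ([], s) := rfl

lemma histEquiv_inr (h : G.Hist) (a : G.Prof h.2) (s : G.S) :
    histEquiv G (Sum.inr ⟨h, a, s⟩) = (⟨h.2, a⟩ :: h.1, s) := rfl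

lemma tsum_hist_ennreal (f : G.Hist → ℝ≥0∞) :
    ∑' h, f h = ∑ s, f ([], s) + ∑' h : G.Hist, ∑ a : G.Prof h.2, ∑ s,
      f (⟨h.2, a⟩ :: h.1, s) := by
  rw [← (histEquiv G).tsum_eq, Summable.tsum_sum ENNReal.summable ENNReal.summable,
    ENNReal.tsum_sigma']
  simp only [tsum_fintype, Fintype.sum_prod_type, histEquiv_inl, histEquiv_inr]

lemma tsum_hist (f : G.Hist → ℝ) (hf : Summable f) :
    ∑' h, f h = ∑ s, f ([], s) + ∑' h : G.Hist, ∑ a : G.Prof h.2, ∑ s,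
      f (⟨h.2, a⟩ :: h.1, s) := by
  have hr : Summable (f ∘ histEquiv G ∘ Sum.inr) :=
    hf.comp_injective ((histEquiv G).injective.comp Sum.inr_injective)
  have hl : Summable (f ∘ histEquiv G ∘ Sum.inl) := Summable.of_finite
  rw [← (histEquiv G).tsum_eq, Summable.tsum_sum (f := fun x => f (histEquiv G x)) hl hr]
  congr 1
  · rw [tsum_fintype]
    rfl
  · refine (hr.tsum_sigma).trans (tsum_congr fun h => ?_)
    rw [tsum_fintype, Fintype.sum_prod_type]
    rfl

lemma probHist_nil (s0 : G.S) (σ : G.Profile) (s : G.S) :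
    probHist s0 σ ([], s) = if s = s0 then 1 else 0 := rfl

lemma probHist_cons (s0 : G.S) (σ : G.Profile) (h : G.Hist) (a : G.Prof h.2) (s : G.S) :
    probHist s0 σ (⟨h.2, a⟩ :: h.1, s) = probHist s0 σ h * actProb σ h a * G.q h.2 a s := rfl

lemma probHist_nonneg (s0 : G.S) (σ : G.Profile) (h : G.Hist) : 0 ≤ probHist s0 σ h := by
  obtain ⟨l, s⟩ := h
  induction l generalizing s with
  | nil => rw [probHist_nil]; split_ifs <;> norm_num
  | cons st rest ih =>
    exact mul_nonneg (mul_nonneg (ih st.1) (actProb_nonneg σ (rest, st.1) st.2))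
      (G.q_nonneg _ _ _)

lemma sum_sum_actProb (σ : G.Profile) (h : G.Hist) (k : ℝ) :
    ∑ a : G.Prof h.2, ∑ s, k * actProb σ h a * G.q h.2 a s = k := by
  simp_rw [← Finset.mul_sum, G.q_sum, mul_one, ← Finset.mul_sum, sum_actProb, mul_one]

lemma tsum_probHist_length (s0 : G.S) (σ : G.Profile) (n : ℕ) :
    ∑' h : G.Hist, (if h.1.length = n then ENNReal.ofReal (probHist s0 σ h) else 0) = 1 := by
  induction n with
  | zero =>
    rw [tsum_hist_ennreal]
    simp [probHist_nil, apply_ite ENNReal.ofReal]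
  | succ n ih =>
    rw [tsum_hist_ennreal, ← ih]
    simp only [List.length_nil, List.length_cons, Nat.add_right_cancel_iff,
      (Nat.succ_ne_zero n).symm, if_false, Finset.sum_const_zero, zero_add]
    refine tsum_congr fun h => ?_
    split_ifs
    · have hn (a : G.Prof h.2) (s : G.S) :
          0 ≤ probHist s0 σ h * actProb σ h a * G.q h.2 a s :=
        mul_nonneg (mul_nonneg (probHist_nonneg s0 σ h) (actProb_nonneg σ h a))
          (G.q_nonneg _ _ _)
      simp_rw [probHist_cons]
      conv_rhs => rw [← sum_sum_actProb σ h (probHist s0 σ h)]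
      rw [ENNReal.ofReal_sum_of_nonneg fun a _ => Finset.sum_nonneg fun s _ => hn a s]
      exact Finset.sum_congr rfl fun a _ =>
        (ENNReal.ofReal_sum_of_nonneg fun s _ => hn a s).symm
    · simp

/-- The discounted probability of a finite history. -/
def discProb (lam : ℝ) (s0 : G.S) (σ : G.Profile) (h : G.Hist) : ℝ :=
  lam ^ h.1.length * probHist s0 σ h

variable {lam : ℝ}

lemma discProb_nonneg (hlam0 : 0 ≤ lam) (s0 : G.S) (σ : G.Profile) (h : G.Hist) :
    0 ≤ discProb lam s0 σ h :=
  mul_nonneg (pow_nonneg hlam0 _) (probHist_nonneg s0 σ h)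

lemma summable_discProb (hlam0 : 0 ≤ lam) (hlam1 : lam < 1) (s0 : G.S) (σ : G.Profile) :
    Summable (discProb lam s0 σ) := by
  have hsum : ∑' h, ENNReal.ofReal (discProb lam s0 σ h) ≠ ⊤ := by
    have h1 (h : G.Hist) : ENNReal.ofReal (discProb lam s0 σ h) =
        ∑' n : ℕ, ENNReal.ofReal lam ^ n *
          (if h.1.length = n then ENNReal.ofReal (probHist s0 σ h) else 0) := by
      rw [tsum_eq_single h.1.length fun n hn => by rw [if_neg hn.symm, mul_zero], if_pos rfl,
        discProb, ENNReal.ofReal_mul (pow_nonneg hlam0 _), ENNReal.ofReal_pow hlam0]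
    simp_rw [h1]
    rw [ENNReal.tsum_comm]
    simp_rw [ENNReal.tsum_mul_left, tsum_probHist_length, mul_one]
    rw [ENNReal.tsum_geometric, ENNReal.inv_ne_top, Ne, tsub_eq_zero_iff_le, not_le]
    simpa using hlam1
  have := ENNReal.summable_toReal hsum
  simpa only [ENNReal.toReal_ofReal (discProb_nonneg hlam0 s0 σ _)] using this

lemma summable_discProb_mul (hlam0 : 0 ≤ lam) (hlam1 : lam < 1) (s0 : G.S) (σ : G.Profile)
    (f : G.Hist → ℝ) {C : ℝ} (hC : ∀ h, |f h| ≤ C) :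
    Summable fun h => discProb lam s0 σ h * f h := by
  refine Summable.of_norm_bounded ((summable_discProb hlam0 hlam1 s0 σ).mul_right C) fun h => ?_
  rw [Real.norm_eq_abs, abs_mul, abs_of_nonneg (discProb_nonneg hlam0 s0 σ h)]
  exact mul_le_mul_of_nonneg_left (hC h) (discProb_nonneg hlam0 s0 σ h)

lemma summable_lastStep (hlam0 : 0 ≤ lam) (hlam1 : lam < 1) (s0 : G.S) (σ : G.Profile)
    (st : G.Step) :
    Summable fun h : G.Hist =>
      if h.1.head? = some st then lam ^ (h.1.length - 1) * probHist s0 σ h else 0 := by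
  have hinj : Function.Injective fun x => histEquiv G (Sum.inr x) :=
    (histEquiv G).injective.comp Sum.inr_injective
  have hn (h : G.Hist) : 0 ≤ lam ^ (h.1.length - 1) * probHist s0 σ h :=
    mul_nonneg (pow_nonneg hlam0 _) (probHist_nonneg s0 σ h)
  have hval (x : Σ h : G.Hist, G.Prof h.2 × G.S) :
      lam ^ ((histEquiv G (Sum.inr x)).1.length - 1) * probHist s0 σ (histEquiv G (Sum.inr x)) =
        discProb lam s0 σ x.1 * actProb σ x.1 x.2.1 * G.q x.1.2 x.2.1 x.2.2 := by
    obtain ⟨h, a, s⟩ := x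
    rw [histEquiv_inr, probHist_cons, List.length_cons, Nat.add_sub_cancel, discProb]
    ring
  have hall : Summable fun x : (Σ h : G.Hist, G.Prof h.2 × G.S) =>
      discProb lam s0 σ x.1 * actProb σ x.1 x.2.1 * G.q x.1.2 x.2.1 x.2.2 := by
    refine (summable_sigma_of_nonneg fun x => (hval x) ▸ hn _).2
      ⟨fun h => Summable.of_finite, ?_⟩
    simp only [tsum_fintype, Fintype.sum_prod_type, sum_sum_actProb]
    exact summable_discProb hlam0 hlam1 s0 σ
  refine (hinj.summable_iff ?_).1 (Summable.of_nonneg_of_le (fun x => ?_) (fun x => ?_) hall)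
  · rintro ⟨l, s⟩ hl
    cases l with
    | nil => simp
    | cons st rest => exact absurd ⟨⟨(rest, st.1), st.2, s⟩, rfl⟩ hl
  · dsimp only [Function.comp_apply]
    split_ifs
    exacts [hn _, le_rfl]
  · rw [← hval x]
    dsimp only [Function.comp_apply]
    split_ifs
    exacts [le_rfl, hn _]

/-- Discounted occupation sums as sums over histories. -/
lemma sum_tStep_mul (hlam0 : 0 ≤ lam) (hlam1 : lam < 1) (s0 : G.S) (σ : G.Profile)
    (r : G.Step → ℝ) :
    ∑ st, tStep lam s0 σ st * r st =
      (1 - lam) * ∑' h : G.Hist, discProb lam s0 σ h *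
        ∑ a : G.Prof h.2, actProb σ h a * r ⟨h.2, a⟩ := by
  have hs (st : G.Step) := (summable_lastStep hlam0 hlam1 s0 σ st).mul_right (r st)
  simp_rw [tStep, mul_assoc, ← tsum_mul_right]
  rw [← Finset.mul_sum, ← Summable.tsum_finsetSum fun st _ => hs st,
    tsum_hist _ (summable_sum fun st _ => hs st)]
  congr 1
  simp only [List.head?_nil, List.head?_cons, reduceCtorEq, if_false, zero_mul,
    Finset.sum_const_zero, zero_add]
  refine tsum_congr fun h => ?_
  rw [Finset.mul_sum]
  refine Finset.sum_congr rfl fun a _ => ?_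
  simp only [Option.some.injEq, ite_mul, zero_mul, Finset.sum_ite_eq, Finset.mem_univ, if_true,
    List.length_cons, Nat.add_sub_cancel, probHist_cons]
  have := G.q_sum h.2 a
  calc
    _ = ∑ s, (lam ^ h.1.length * probHist s0 σ h * actProb σ h a * r ⟨h.2, a⟩) *
          G.q h.2 a s := Finset.sum_congr rfl fun s _ => by ring
    _ = _ := by rw [← Finset.mul_sum, this, discProb]; ring

/-- The one-stage payoff plus the discounted continuation value. -/
def bellman (lam : ℝ) (r : G.Step → ℝ) (V : G.S → ℝ) (s : G.S) (a : G.Prof s) : ℝ :=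
  (1 - lam) * r ⟨s, a⟩ + lam * ∑ s', G.q s a s' * V s'

/-- Verification: a function that is dominated by its one-stage continuation along every
history is a lower bound for the discounted sum. -/
lemma le_sum_tStep_mul (hlam0 : 0 ≤ lam) (hlam1 : lam < 1) (s0 : G.S) (σ : G.Profile)
    (r : G.Step → ℝ) (V : G.S → ℝ)
    (hV : ∀ h : G.Hist, V h.2 ≤ ∑ a, actProb σ h a * bellman lam r V h.2 a) :
    V s0 ≤ ∑ st, tStep lam s0 σ st * r st := by
  have havg (f : (s : G.S) → G.Prof s → ℝ) {C : ℝ} (hC : ∀ s a, |f s a| ≤ C) :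
      Summable fun h : G.Hist => discProb lam s0 σ h * ∑ a, actProb σ h a * f h.2 a := by
    refine summable_discProb_mul hlam0 hlam1 s0 σ _ (C := C) fun h => ?_
    calc
      _ ≤ ∑ a, |actProb σ h a * f h.2 a| := Finset.abs_sum_le_sum_abs _ _
      _ ≤ ∑ a, actProb σ h a * C := Finset.sum_le_sum fun a _ => by
          rw [abs_mul, abs_of_nonneg (actProb_nonneg σ h a)]
          exact mul_le_mul_of_nonneg_left (hC _ _) (actProb_nonneg σ h a)
      _ = C := by rw [← Finset.sum_mul, sum_actProb, one_mul]
  have hbdd (f : (s : G.S) → G.Prof s → ℝ) : ∃ C, ∀ s a, |f s a| ≤ C := by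
    obtain ⟨C, hC⟩ := (Set.finite_range fun st : G.Step => |f st.1 st.2|).bddAbove
    exact ⟨C, fun s a => hC ⟨⟨s, a⟩, rfl⟩⟩
  have hsum (f : (s : G.S) → G.Prof s → ℝ) :
      Summable fun h : G.Hist => discProb lam s0 σ h * ∑ a, actProb σ h a * f h.2 a :=
    havg f (hbdd f).choose_spec
  have hsV : Summable fun h : G.Hist => discProb lam s0 σ h * V h.2 := by
    simpa only [← Finset.sum_mul, sum_actProb, one_mul] using hsum fun s _ => V s
  have hrec := tsum_hist _ hsV
  have hstep (h : G.Hist) : ∑ a : G.Prof h.2, ∑ s,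
      discProb lam s0 σ (⟨h.2, a⟩ :: h.1, s) * V s =
      lam * (discProb lam s0 σ h * ∑ a, actProb σ h a * ∑ s', G.q h.2 a s' * V s') := by
    simp only [Finset.mul_sum]
    refine Finset.sum_congr rfl fun a _ => Finset.sum_congr rfl fun s _ => ?_
    rw [discProb, discProb, probHist_cons, List.length_cons, pow_succ]
    ring
  have hnil : ∑ s, discProb lam s0 σ ([], s) * V s = V s0 := by
    simp [discProb, probHist_nil]
  simp only [hstep] at hrec
  rw [hnil, tsum_mul_left] at hrec
  have hle := hsV.tsum_le_tsum (fun h => mul_le_mul_of_nonneg_left (hV h)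
    (discProb_nonneg hlam0 s0 σ h)) (hsum (bellman lam r V))
  have hsplit : ∑' h : G.Hist, discProb lam s0 σ h *
      ∑ a, actProb σ h a * bellman lam r V h.2 a =
      (1 - lam) * (∑' h : G.Hist, discProb lam s0 σ h * ∑ a, actProb σ h a * r ⟨h.2, a⟩) +
      lam * ∑' h : G.Hist, discProb lam s0 σ h *
        ∑ a, actProb σ h a * ∑ s', G.q h.2 a s' * V s' := by
    rw [← tsum_mul_left, ← tsum_mul_left, ← Summable.tsum_add
      ((hsum fun s a => r ⟨s, a⟩).mul_left _)
      ((hsum fun s a => ∑ s', G.q s a s' * V s').mul_left _)]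
    refine tsum_congr fun h => ?_
    simp only [bellman, Finset.mul_sum, ← Finset.sum_add_distrib, mul_add]
    refine Finset.sum_congr rfl fun a _ => ?_
    congr 1
    · ring
    · exact Finset.sum_congr rfl fun s _ => by ring
  rw [sum_tStep_mul hlam0 hlam1]
  linarith

lemma bellman_neg (r : G.Step → ℝ) (V : G.S → ℝ) (s : G.S) (a : G.Prof s) :
    bellman lam (fun st => -r st) (fun s => -V s) s a = -bellman lam r V s a := by
  simp only [bellman, mul_neg, Finset.sum_neg_distrib]
  ring

lemma sum_tStep_mul_le (hlam0 : 0 ≤ lam) (hlam1 : lam < 1) (s0 : G.S) (σ : G.Profile)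
    (r : G.Step → ℝ) (V : G.S → ℝ)
    (hV : ∀ h : G.Hist, ∑ a, actProb σ h a * bellman lam r V h.2 a ≤ V h.2) :
    ∑ st, tStep lam s0 σ st * r st ≤ V s0 := by
  have := le_sum_tStep_mul hlam0 hlam1 s0 σ (fun st => -r st) (fun s => -V s) fun h => by
    simpa only [bellman_neg, mul_neg, Finset.sum_neg_distrib, neg_le_neg_iff] using hV h
  simpa only [mul_neg, Finset.sum_neg_distrib, neg_le_neg_iff] using this

lemma sum_tStep (hlam0 : 0 ≤ lam) (hlam1 : lam < 1) (s0 : G.S) (σ : G.Profile) :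
    ∑ st, tStep lam s0 σ st = 1 := by
  have hb (h : G.Hist) :
      ∑ a, actProb σ h a * bellman lam (fun _ => 1) (fun _ => 1) h.2 a = 1 := by
    simp [bellman, G.q_sum, sum_actProb]
  refine le_antisymm ?_ ?_
  · simpa using sum_tStep_mul_le hlam0 hlam1 s0 σ (fun _ => 1) (fun _ => 1) fun h => (hb h).le
  · simpa using le_sum_tStep_mul hlam0 hlam1 s0 σ (fun _ => 1) (fun _ => 1) fun h => (hb h).ge

lemma tStep_nonneg (hlam0 : 0 ≤ lam) (hlam1 : lam < 1) (s0 : G.S) (σ : G.Profile)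
    (st : G.Step) : 0 ≤ tStep lam s0 σ st := by
  refine mul_nonneg (sub_nonneg.2 hlam1.le) (tsum_nonneg fun h => ?_)
  split_ifs
  · exact mul_nonneg (pow_nonneg hlam0 _) (probHist_nonneg s0 σ h)
  · exact le_rfl

lemma abs_sum_ite_tStep_le (hlam0 : 0 ≤ lam) (hlam1 : lam < 1) (s0 : G.S) (σ : G.Profile)
    (D : Finset G.S) (r : G.Step → ℝ) (hr : ∀ st, |r st| ≤ 1) :
    |∑ st : G.Step, if st.1 ∈ D then tStep lam s0 σ st * r st else 0| ≤ 1 := by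
  rw [← sum_tStep hlam0 hlam1 s0 σ]
  refine (Finset.abs_sum_le_sum_abs _ _).trans (Finset.sum_le_sum fun st _ => ?_)
  have h0 := tStep_nonneg hlam0 hlam1 s0 σ st
  split_ifs
  · rw [abs_mul, abs_of_nonneg h0]
    exact mul_le_of_le_one_right h0 (hr st)
  · simpa using h0

lemma abs_modPayoff_le (hlam0 : 0 ≤ lam) (hlam1 : lam < 1) (s0 : G.S) (σ : G.Profile)
    (i : G.I) (Di : Finset (Finset G.S)) (c : Finset G.S → ℝ) :
    |modPayoff lam s0 σ i Di c| ≤ ∑ D ∈ Di, (1 + |c D|) := by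
  refine (Finset.abs_sum_le_sum_abs _ _).trans (Finset.sum_le_sum fun D _ => ?_)
  have hU : |UD lam s0 σ i D| ≤ 1 :=
    abs_sum_ite_tStep_le hlam0 hlam1 s0 σ D _ fun st => G.u_bdd i st.1 st.2
  have ht : |tSet lam s0 σ D| ≤ 1 := by
    simpa [tSet] using abs_sum_ite_tStep_le hlam0 hlam1 s0 σ D (fun _ => 1) (by simp)
  have htc : |tSet lam s0 σ D * c D| ≤ |c D| := by
    rw [abs_mul]
    exact mul_le_of_le_one_left (abs_nonneg _) ht
  refine abs_min_le_max_abs_abs.trans (max_le ?_ ?_)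
  · linarith [abs_nonneg (c D)]
  · linarith

/-! ### Minimizing a discounted sum against a stationary strategy -/

/-- The expected one-stage value when player `i` plays `x` and the others play `a`. -/
def reply {i : G.I} (x : G.Stat i) (lam : ℝ) (r : G.Step → ℝ) (V : G.S → ℝ) (s : G.S)
    (a : G.Prof s) : ℝ :=
  ∑ b, (x s).1 b * bellman lam r V s (Function.update a i b)

lemma reply_le_add {i : G.I} (hlam0 : 0 ≤ lam) (x : G.Stat i) (r : G.Step → ℝ)
    (V W : G.S → ℝ) (s : G.S) (a : G.Prof s) :
    reply x lam r V s a ≤ reply x lam r W s a + lam * dist V W := by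
  have hb (a : G.Prof s) : bellman lam r V s a ≤ bellman lam r W s a + lam * dist V W := by
    have : ∑ s', G.q s a s' * V s' ≤ ∑ s', G.q s a s' * W s' + dist V W := by
      calc
        _ ≤ ∑ s', G.q s a s' * (W s' + dist V W) := Finset.sum_le_sum fun s' _ => by
            refine mul_le_mul_of_nonneg_left ?_ (G.q_nonneg _ _ _)
            have h1 := dist_le_pi_dist V W s'
            rw [Real.dist_eq] at h1
            linarith [le_abs_self (V s' - W s')]
        _ = _ := by
            simp only [mul_add, Finset.sum_add_distrib]
            rw [← Finset.sum_mul, G.q_sum, one_mul]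
    have := mul_le_mul_of_nonneg_left this hlam0
    simp only [bellman]
    linarith
  calc
    _ ≤ ∑ b, (x s).1 b * (bellman lam r W s (Function.update a i b) + lam * dist V W) :=
        Finset.sum_le_sum fun b _ => mul_le_mul_of_nonneg_left (hb _) ((x s).2.1 b)
    _ = _ := by
        simp only [mul_add, Finset.sum_add_distrib]
        rw [← Finset.sum_mul, (x s).2.2, one_mul]
        rfl

/-- The Bellman equation of the opponents' minimization problem has a solution. -/
lemma exists_bellman_fixedPoint {i : G.I} (hlam0 : 0 ≤ lam) (hlam1 : lam < 1) (x : G.Stat i)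
    (r : G.Step → ℝ) :
    ∃ (V : G.S → ℝ) (b : (s : G.S) → G.Prof s),
      (∀ s, reply x lam r V s (b s) = V s) ∧ ∀ s a, V s ≤ reply x lam r V s a := by
  let T : (G.S → ℝ) → (G.S → ℝ) := fun V s =>
    Finset.univ.inf' Finset.univ_nonempty (reply x lam r V s)
  have hT1 (V W : G.S → ℝ) (s : G.S) : T V s ≤ T W s + lam * dist V W := by
    obtain ⟨a, -, ha⟩ :=
      Finset.exists_mem_eq_inf' (Finset.univ_nonempty (α := G.Prof s)) (reply x lam r W s)
    calc
      T V s ≤ reply x lam r V s a := Finset.inf'_le _ (Finset.mem_univ a)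
      _ ≤ _ := reply_le_add hlam0 x r V W s a
      _ = _ := by rw [← ha]
  have hT : ContractingWith ⟨lam, hlam0⟩ T := by
    refine ⟨hlam1, LipschitzWith.of_dist_le_mul fun V W => ?_⟩
    refine (dist_pi_le_iff (mul_nonneg hlam0 dist_nonneg)).2 fun s => ?_
    have h1 := hT1 V W s
    have h2 := hT1 W V s
    rw [dist_comm W V] at h2
    rw [Real.dist_eq, abs_le]
    change -(lam * dist V W) ≤ _ ∧ _ ≤ lam * dist V W
    constructor <;> linarith
  let V := ContractingWith.fixedPoint T hT
  have hV : T V = V := hT.fixedPoint_isFixedPt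
  have hb (s : G.S) : ∃ a, reply x lam r V s a = V s := by
    obtain ⟨a, -, ha⟩ :=
      Finset.exists_mem_eq_inf' (Finset.univ_nonempty (α := G.Prof s)) (reply x lam r V s)
    exact ⟨a, ha.symm.trans (congrFun hV s)⟩
  choose b hb using hb
  exact ⟨V, b, hb, fun s a => (congrFun hV s).ge.trans (Finset.inf'_le _ (Finset.mem_univ a))⟩

lemma sum_actProb_bellman {i : G.I} (x : G.Stat i) (σ : G.Profile) (r : G.Step → ℝ)
    (V : G.S → ℝ) (h : G.Hist) :
    ∑ a, actProb (Function.update σ i (toB1 x)) h a * bellman lam r V h.2 a =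
      ∑ a, actProb (Function.update σ i (toB1 x)) h a * reply x lam r V h.2 a := by
  have := sum_prod_mixed_resample (fun j => Function.update σ i (toB1 x) j h) i
    (bellman lam r V h.2)
  simp only [Function.update_self, toB1] at this
  exact this.symm

/-- Against a stationary strategy, the opponents have a stationary reply that minimizes
a discounted sum. -/
lemma exists_stationary_minimizer {i : G.I} (hlam0 : 0 ≤ lam) (hlam1 : lam < 1) (s0 : G.S)
    (x : G.Stat i) (r : G.Step → ℝ) :
    ∃ y : G.StatProf, ∀ σ : G.Profile,
      ∑ st, tStep lam s0 (Function.update (toB y) i (toB1 x)) st * r st ≤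
        ∑ st, tStep lam s0 (Function.update σ i (toB1 x)) st * r st := by
  obtain ⟨V, b, hb, hV⟩ := exists_bellman_fixedPoint hlam0 hlam1 x r
  let y : G.StatProf := fun j s => ⟨fun a => if a = b s j then 1 else 0,
    fun a => by dsimp only; split_ifs <;> norm_num, by simp⟩
  refine ⟨y, fun σ => le_trans (b := V s0) ?_ ?_⟩
  · refine sum_tStep_mul_le hlam0 hlam1 s0 _ r V fun h => ?_
    rw [sum_actProb_bellman]
    have hterm (a : G.Prof h.2) :
        actProb (Function.update (toB y) i (toB1 x)) h a * reply x lam r V h.2 a =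
        actProb (Function.update (toB y) i (toB1 x)) h a * V h.2 := by
      by_cases ha : ∀ j, j ≠ i → a j = b h.2 j
      · have hab : reply x lam r V h.2 a = reply x lam r V h.2 (b h.2) := by
          refine Finset.sum_congr rfl fun d _ => ?_
          congr 2
          ext j
          by_cases hj : j = i
          · subst hj; simp
          · simp [Function.update_of_ne hj, ha j hj]
        rw [hab, hb]
      · push Not at ha
        obtain ⟨j, hj, haj⟩ := ha
        have : actProb (Function.update (toB y) i (toB1 x)) h a = 0 := by
          refine Finset.prod_eq_zero (Finset.mem_univ j) ?_
          rw [Function.update_of_ne hj]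
          exact if_neg haj
        rw [this, zero_mul, zero_mul]
    rw [Finset.sum_congr rfl fun a _ => hterm a, ← Finset.sum_mul, sum_actProb, one_mul]
  · refine le_sum_tStep_mul hlam0 hlam1 s0 _ r V fun h => ?_
    rw [sum_actProb_bellman]
    calc
      V h.2 = ∑ a, actProb (Function.update σ i (toB1 x)) h a * V h.2 := by
        rw [← Finset.sum_mul, sum_actProb, one_mul]
      _ ≤ _ := Finset.sum_le_sum fun a _ =>
        mul_le_mul_of_nonneg_left (hV _ _) (actProb_nonneg _ h a)

/-- Against a stationary strategy, stationary replies minimize the modified payoff. -/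
lemma exists_stationary_modPayoff_le {i : G.I} (hlam0 : 0 ≤ lam) (hlam1 : lam < 1) (s0 : G.S)
    (x : G.Stat i) (σ : G.Profile) (Di : Finset (Finset G.S)) (c : Finset G.S → ℝ) :
    ∃ y : G.StatProf,
      modPayoff lam s0 (Function.update (toB y) i (toB1 x)) i Di c ≤
        modPayoff lam s0 (Function.update σ i (toB1 x)) i Di c := by
  classical
  set τ := Function.update σ i (toB1 x)
  let f : Finset G.S → G.Step → ℝ := fun D st =>
    if UD lam s0 τ i D ≤ tSet lam s0 τ D * c D then G.u i st.1 st.2 else c D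
  let r : G.Step → ℝ := fun st => ∑ D ∈ Di, if st.1 ∈ D then f D st else 0
  have hlin (ρ : G.Profile) : ∑ st, tStep lam s0 ρ st * r st =
      ∑ D ∈ Di, if UD lam s0 τ i D ≤ tSet lam s0 τ D * c D then UD lam s0 ρ i D
        else tSet lam s0 ρ D * c D := by
    simp only [r, Finset.mul_sum]
    rw [Finset.sum_comm]
    refine Finset.sum_congr rfl fun D _ => ?_
    simp only [f]
    split_ifs
    · simp only [UD, mul_ite, mul_zero]
    · simp only [tSet, Finset.sum_mul, mul_ite, mul_zero, ite_mul, zero_mul]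
  obtain ⟨y, hy⟩ := exists_stationary_minimizer hlam0 hlam1 s0 x r
  refine ⟨y, ?_⟩
  calc
    _ ≤ ∑ st, tStep lam s0 (Function.update (toB y) i (toB1 x)) st * r st := by
      rw [hlin]
      refine Finset.sum_le_sum fun D _ => ?_
      split_ifs
      · exact min_le_left _ _
      · exact min_le_right _ _
    _ ≤ ∑ st, tStep lam s0 τ st * r st := hy σ
    _ = _ := by
      rw [hlin]
      exact Finset.sum_congr rfl fun D _ => min_def _ _ |>.symm

end StocGame

open StocGame in
/-- the max-min value in stationary strategies of the modified game is at
most the max-min value of the modified game. -/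
theorem stmt_17 (G : StocGame) (lam : ℝ) (hlam0 : 0 ≤ lam) (hlam1 : lam < 1) (s0 : G.S)
    (i : G.I) (Di : Finset (Finset G.S)) (hDi : IsPartitionF Di)
    (c : Finset G.S → ℝ) :
    maxminModStat G lam s0 i Di c ≤ maxminMod G lam s0 i Di c := by
  have hbelow (σi : G.BStrat i) : BddBelow (Set.range fun σ : G.Profile =>
      modPayoff lam s0 (Function.update σ i σi) i Di c) := by
    refine ⟨-∑ D ∈ Di, (1 + |c D|), ?_⟩
    rintro _ ⟨σ, rfl⟩
    exact neg_le_of_abs_le (abs_modPayoff_le hlam0 hlam1 s0 _ i Di c)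
  have hbelow' (x : G.Stat i) : BddBelow (Set.range fun y : G.StatProf =>
      modPayoff lam s0 (Function.update (toB y) i (toB1 x)) i Di c) := by
    refine (hbelow (toB1 x)).mono ?_
    rintro _ ⟨y, rfl⟩
    exact ⟨toB y, rfl⟩
  have habove : BddAbove (Set.range fun σi : G.BStrat i => ⨅ σ : G.Profile,
      modPayoff lam s0 (Function.update σ i σi) i Di c) := by
    refine ⟨∑ D ∈ Di, (1 + |c D|), ?_⟩
    rintro _ ⟨σi, rfl⟩
    exact (ciInf_le (hbelow σi) (Classical.arbitrary _)).trans
      (le_of_abs_le (abs_modPayoff_le hlam0 hlam1 s0 _ i Di c))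
  refine ciSup_le fun x => le_ciSup_of_le habove (toB1 x) (le_ciInf fun σ => ?_)
  obtain ⟨y, hy⟩ := exists_stationary_modPayoff_le hlam0 hlam1 s0 x σ Di c
  exact ciInf_le_of_le (hbelow' x) y hy
end
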